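/- The set S̃ generates the group W̃; in particular, every w ∈ W̃ admits a decomposition w = w₁ ⋯ w_q with w_i ∈ S̃, so ℓ̃(w) < ∞ for all w ∈ W̃. Moreover, for every w ∈ W̃ with w ≠ e and every s ∈ D(w) one has s ∈ S ∖ Σ, s ∈ Σ^∁, and ℓ(s̃ w) = ℓ(w) − ℓ(s̃), where s̃ = w₀^{Σ∪{s}} w₀^Σ. -/

import Mathlib

/-!
Relative Coxeter groups: common definitions.

`(W, S)` is a Coxeter system (Mathlib's `CoxeterSystem M W`), `ℓ = cs.length`.
For `w : W`, `invSet cs w` is the set `T(w)` of left inversions of `w`, and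
`descSet cs w = T(w) ∩ S` is `D(w)`.  For a subset `Sg ⊆ S` (playing the role of `Σ`),
`par Sg` is the standard parabolic subgroup `W_Σ`, `parRefl Sg` its set of
reflections `T_Σ`, `minRight cs Sg = W^Σ`, `minLeft cs Sg = ^ΣW`,
`relN cs Sg Sg' = N(Σ, Σ')`, `IsLongest cs Sg w` says `w` is a longest element of `W_Σ`,
`longest cs Sg` is the longest element `w₀^Σ`, `relW cs Sg = W̃`,
`complSet cs Sg = Σ^∁`, `tilde cs Sg s = s̃ = w₀^{Σ∪{s}} w₀^Σ`, `relS cs Sg = S̃`,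
`relLength cs Sg = ℓ̃ : W → ℕ∞`, and `GoodSubset cs Sg` records the standing
hypotheses (1) and (2) on `Σ`.
-/

namespace RelativeCoxeter

variable {B W : Type*} [Group W] {M : CoxeterMatrix B}

/-- The set `S` of simple reflections of the Coxeter system. -/
def simpleSet (cs : CoxeterSystem M W) : Set W := Set.range cs.simple

/-- `T(w)`: the set of left inversions of `w`, i.e. reflections `t` with `ℓ(tw) < ℓ(w)`. -/
def invSet (cs : CoxeterSystem M W) (w : W) : Set W :=
  {t | cs.IsReflection t ∧ cs.length (t * w) < cs.length w}

/-- `D(w) = T(w) ∩ S`. -/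
def descSet (cs : CoxeterSystem M W) (w : W) : Set W :=
  invSet cs w ∩ simpleSet cs

/-- The standard parabolic subgroup `W_Σ` generated by `Σ`. -/
def par (Sg : Set W) : Subgroup W := Subgroup.closure Sg

/-- `T_Σ`: the set of reflections of the Coxeter system `(W_Σ, Σ)`. -/
def parRefl (Sg : Set W) : Set W :=
  {t | ∃ u ∈ par Sg, ∃ s ∈ Sg, t = u * s * u⁻¹}

/-- `W^Σ = {w : T(w⁻¹) ∩ T_Σ = ∅}`, minimal-length representatives of `W/W_Σ`. -/
def minRight (cs : CoxeterSystem M W) (Sg : Set W) : Set W :=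
  {w | invSet cs w⁻¹ ∩ parRefl Sg = ∅}

/-- `^ΣW = {w : T(w) ∩ T_Σ = ∅}`, minimal-length representatives of `W_Σ\W`. -/
def minLeft (cs : CoxeterSystem M W) (Sg : Set W) : Set W :=
  {w | invSet cs w ∩ parRefl Sg = ∅}

/-- `N(Σ, Σ') = {y ∈ W^Σ ∩ ^{Σ'}W : y W_Σ y⁻¹ = W_{Σ'}}`. -/
def relN (cs : CoxeterSystem M W) (Sg Sg' : Set W) : Set W :=
  {y | y ∈ minRight cs Sg ∧ y ∈ minLeft cs Sg' ∧
    (fun u => y * u * y⁻¹) '' (par Sg : Set W) = (par Sg' : Set W)}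

/-- `w` is a longest element of `W_Σ`. -/
def IsLongest (cs : CoxeterSystem M W) (Sg : Set W) (w : W) : Prop :=
  w ∈ par Sg ∧ ∀ u ∈ par Sg, cs.length u ≤ cs.length w

/-- The longest element `w₀^Σ` of `W_Σ` (defined when it exists; junk value `1` otherwise). -/
noncomputable def longest (cs : CoxeterSystem M W) (Sg : Set W) : W :=
  letI := Classical.propDecidable (∃ w, IsLongest cs Sg w)
  if h : ∃ w, IsLongest cs Sg w then h.choose else 1

/-- `W̃ = {w : w W_Σ w⁻¹ = W_Σ and T(w) ∩ T_Σ = ∅}`. -/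
def relW (cs : CoxeterSystem M W) (Sg : Set W) : Set W :=
  {w | (fun u => w * u * w⁻¹) '' (par Sg : Set W) = (par Sg : Set W) ∧
    invSet cs w ∩ parRefl Sg = ∅}

/-- `Σ^∁ = {s ∈ S ∖ Σ : W_{Σ∪{s}} is finite}`. -/
def complSet (cs : CoxeterSystem M W) (Sg : Set W) : Set W :=
  {s ∈ simpleSet cs \ Sg | ((par (Sg ∪ {s}) : Set W)).Finite}

/-- `s̃ = w₀^{Σ∪{s}} w₀^Σ`. -/
noncomputable def tilde (cs : CoxeterSystem M W) (Sg : Set W) (s : W) : W :=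
  longest cs (Sg ∪ {s}) * longest cs Sg

/-- `S̃ = {s̃ : s ∈ Σ^∁}`. -/
noncomputable def relS (cs : CoxeterSystem M W) (Sg : Set W) : Set W :=
  {w | ∃ s ∈ complSet cs Sg, w = tilde cs Sg s}

/-- `ℓ̃(w) ∈ ℕ ∪ {∞}`: the minimal `q` such that `w = w₁ ⋯ w_q` with all `w_i ∈ S̃`. -/
noncomputable def relLength (cs : CoxeterSystem M W) (Sg : Set W) (w : W) : ℕ∞ :=
  sInf {q : ℕ∞ | ∃ l : List W, (∀ x ∈ l, x ∈ relS cs Sg) ∧ l.prod = w ∧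
    (l.length : ℕ∞) = q}

/-- The standing hypotheses on `Σ`: `Σ ⊆ S`, `W_Σ` is finite, and for every `Σ'` with
`Σ ⊆ Σ' ⊆ S` and `W_{Σ'}` finite, the longest element `w₀^{Σ'}` normalises `W_Σ`. -/
def GoodSubset (cs : CoxeterSystem M W) (Sg : Set W) : Prop :=
  Sg ⊆ simpleSet cs ∧ ((par Sg : Set W)).Finite ∧
  ∀ Sg' : Set W, Sg ⊆ Sg' → Sg' ⊆ simpleSet cs → ((par Sg' : Set W)).Finite →
    ∀ w0 : W, IsLongest cs Sg' w0 →
      (fun u => w0 * u * w0⁻¹) '' (par Sg : Set W) = (par Sg : Set W)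

section StrongExchange

open List CoxeterSystem

open Classical in
/-- The action of a simple reflection on `W × ZMod 2` which conjugates the first coordinate and
flips the second one exactly at the reflection itself. -/
noncomputable def signedConj (cs : CoxeterSystem M W) (i : B) : Function.End (W × ZMod 2) :=
  fun p => (cs.simple i * p.1 * cs.simple i, p.2 + if p.1 = cs.simple i then 1 else 0)

open Classical in
theorem prod_map_signedConj (cs : CoxeterSystem M W) (ω : List B) (p : W × ZMod 2) :
    (ω.map (signedConj cs)).prod p =
      (cs.wordProd ω * p.1 * (cs.wordProd ω)⁻¹, p.2 + (cs.rightInvSeq ω).count p.1) := by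
  induction ω with
  | nil => simp [Function.End.one_def]
  | cons i ω ih =>
    rw [List.map_cons, List.prod_cons]
    change signedConj cs i ((ω.map (signedConj cs)).prod p) = _
    rw [ih]
    simp only [signedConj, rightInvSeq, cs.wordProd_cons, List.count_cons, mul_inv_rev,
      cs.inv_simple, Prod.mk.injEq, beq_iff_eq]
    have h : cs.wordProd ω * p.1 * (cs.wordProd ω)⁻¹ = cs.simple i ↔
        (cs.wordProd ω)⁻¹ * cs.simple i * cs.wordProd ω = p.1 := by
      constructor
      · intro h; rw [← h]; group
      · intro h; rw [← h]; group
    refine ⟨by group, ?_⟩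
    simp only [h]
    split_ifs <;> push_cast <;> ring

theorem alternatingWord_two_mul_succ (i j : B) (m : ℕ) :
    alternatingWord i j (2 * (m + 1)) = i :: j :: alternatingWord i j (2 * m) := by
  rw [show 2 * (m + 1) = 2 * m + 1 + 1 by ring, alternatingWord_succ', alternatingWord_succ']
  simp [parity_simps]

theorem reverse_alternatingWord_two_mul (i j : B) (m : ℕ) :
    (alternatingWord i j (2 * m)).reverse = alternatingWord j i (2 * m) := by
  induction m with
  | zero => simp [alternatingWord]
  | succ m ih =>
    rw [alternatingWord_two_mul_succ j i, ← ih, show 2 * (m + 1) = 2 * m + 1 + 1 by ring,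
      alternatingWord_succ, alternatingWord_succ]
    simp

open Classical in
theorem even_count_leftInvSeq_alternatingWord (cs : CoxeterSystem M W) (i j : B) (x : W) :
    Even ((cs.leftInvSeq (alternatingWord i j (2 * M i j))).count x) := by
  set l := cs.leftInvSeq (alternatingWord i j (2 * M i j)) with hl
  have hlen : l.length = 2 * M i j := by simp [hl]
  have hdrop : l.drop (M i j) = l.take (M i j) := by
    apply List.ext_getElem
    · simp [hlen]; omega
    · intro k h₁ h₂
      rw [List.length_take, hlen] at h₂
      have hk : k < M i j := by omega
      rw [List.getElem_drop, List.getElem_take]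
      simp only [hl]
      rw [cs.getElem_leftInvSeq_alternatingWord i j _ _ (by omega),
        cs.getElem_leftInvSeq_alternatingWord i j _ _ (by omega)]
      simp only [prod_alternatingWord_eq_mul_pow]
      have e1 : ¬ Even (2 * (M i j + k) + 1) := by simp [parity_simps]
      have e2 : ¬ Even (2 * k + 1) := by simp [parity_simps]
      rw [if_neg e1, if_neg e2, show (2 * (M i j + k) + 1) / 2 = M i j + k by omega,
        show (2 * k + 1) / 2 = k by omega, pow_add]
      simp
  rw [← List.take_append_drop (M i j) l, List.count_append, hdrop]
  exact ⟨_, rfl⟩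

theorem isLiftable_signedConj (cs : CoxeterSystem M W) : M.IsLiftable (signedConj cs) := by
  classical
  intro i j
  have hpow : ∀ m : ℕ, (signedConj cs i * signedConj cs j) ^ m =
      ((alternatingWord i j (2 * m)).map (signedConj cs)).prod := by
    intro m
    induction m with
    | zero => simp [alternatingWord]
    | succ m ih => rw [alternatingWord_two_mul_succ, pow_succ', ih]; simp [mul_assoc]
  rw [hpow]
  funext p
  rw [prod_map_signedConj, Function.End.one_def]
  have h1 : cs.wordProd (alternatingWord i j (2 * M i j)) = 1 := by
    rw [prod_alternatingWord_eq_mul_pow]; simp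
  have h2 : Even ((cs.rightInvSeq (alternatingWord i j (2 * M i j))).count p.1) := by
    rw [← reverse_alternatingWord_two_mul, rightInvSeq_reverse, List.count_reverse,
      M.symmetric i j]
    exact even_count_leftInvSeq_alternatingWord cs j i p.1
  rw [h1, (ZMod.natCast_eq_zero_iff_even).2 h2]
  simp

/-- The parity of the number of occurrences of `t` in the left inversion sequence of any word
for `w`. -/
noncomputable def invParity (cs : CoxeterSystem M W) (w t : W) : ZMod 2 :=
  (cs.lift ⟨signedConj cs, isLiftable_signedConj cs⟩ w⁻¹ (t, 0)).2

open Classical in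
theorem lift_signedConj_wordProd (cs : CoxeterSystem M W) (ω : List B) (p : W × ZMod 2) :
    cs.lift ⟨signedConj cs, isLiftable_signedConj cs⟩ (cs.wordProd ω) p =
      (cs.wordProd ω * p.1 * (cs.wordProd ω)⁻¹, p.2 + (cs.rightInvSeq ω).count p.1) := by
  have h : cs.lift ⟨signedConj cs, isLiftable_signedConj cs⟩ ∘ cs.simple = signedConj cs :=
    funext fun i => cs.lift_apply_simple _ i
  rw [← prod_map_signedConj, wordProd, map_list_prod, List.map_map, h]

open Classical in
theorem invParity_wordProd (cs : CoxeterSystem M W) (ω : List B) (t : W) :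
    invParity cs (cs.wordProd ω) t = (cs.leftInvSeq ω).count t := by
  rw [invParity, ← wordProd_reverse, lift_signedConj_wordProd, rightInvSeq_reverse,
    List.count_reverse]
  simp

theorem lift_signedConj_inv (cs : CoxeterSystem M W) (w : W) (p : W × ZMod 2) :
    cs.lift ⟨signedConj cs, isLiftable_signedConj cs⟩ w⁻¹ p =
      (w⁻¹ * p.1 * w, p.2 + invParity cs w p.1) := by
  classical
  obtain ⟨ω, rfl⟩ := cs.wordProd_surjective w
  rw [invParity_wordProd, ← wordProd_reverse, lift_signedConj_wordProd, rightInvSeq_reverse,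
    List.count_reverse]
  simp

theorem invParity_mul (cs : CoxeterSystem M W) (a b t : W) :
    invParity cs (a * b) t = invParity cs a t + invParity cs b (a⁻¹ * t * a) := by
  let φ := cs.lift ⟨signedConj cs, isLiftable_signedConj cs⟩
  have h : φ (a * b)⁻¹ (t, 0) = φ b⁻¹ (φ a⁻¹ (t, 0)) := by
    rw [mul_inv_rev, map_mul]; rfl
  change (φ (a * b)⁻¹ (t, 0)).2 = _
  rw [h, lift_signedConj_inv, lift_signedConj_inv]
  simp

theorem invParity_one (cs : CoxeterSystem M W) (t : W) : invParity cs 1 t = 0 := by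
  classical
  simpa using invParity_wordProd cs [] t

theorem invParity_simple_self (cs : CoxeterSystem M W) (i : B) :
    invParity cs (cs.simple i) (cs.simple i) = 1 := by
  classical
  simpa using invParity_wordProd cs [i] (cs.simple i)

theorem invParity_self (cs : CoxeterSystem M W) {t : W} (ht : cs.IsReflection t) :
    invParity cs t t = 1 := by
  obtain ⟨u, i, rfl⟩ := ht
  have h := invParity_mul cs u u⁻¹ (u * cs.simple i * u⁻¹)
  rw [mul_inv_cancel, invParity_one] at h
  rw [mul_assoc u, invParity_mul, invParity_mul]
  have e : u⁻¹ * (u * (cs.simple i * u⁻¹)) * u = cs.simple i := by group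
  have e' : u⁻¹ * (u * cs.simple i * u⁻¹) * u = cs.simple i := by group
  rw [e'] at h
  rw [e, invParity_simple_self]
  simp only [inv_simple, simple_mul_simple_self, one_mul]
  rw [← mul_assoc u]
  linear_combination -h

theorem zmod_two_eq_one_of_ne_zero {a : ZMod 2} (h : a ≠ 0) : a = 1 := by
  revert a; decide

theorem mem_leftInvSeq_of_invParity_ne_zero (cs : CoxeterSystem M W) {ω : List B} {t : W}
    (h : invParity cs (cs.wordProd ω) t ≠ 0) : t ∈ cs.leftInvSeq ω := by
  classical
  rw [invParity_wordProd] at h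
  by_contra hn
  rw [List.count_eq_zero_of_not_mem hn] at h
  simp at h

theorem length_mul_lt_of_invParity_ne_zero (cs : CoxeterSystem M W) {w t : W}
    (h : invParity cs w t ≠ 0) : cs.length (t * w) < cs.length w := by
  obtain ⟨ω, hω, rfl⟩ := cs.exists_isReduced w
  exact (cs.isLeftInversion_of_mem_leftInvSeq hω
    (mem_leftInvSeq_of_invParity_ne_zero cs h)).2

theorem length_mul_lt_iff_invParity (cs : CoxeterSystem M W) {t : W} (ht : cs.IsReflection t)
    (w : W) : cs.length (t * w) < cs.length w ↔ invParity cs w t = 1 := by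
  constructor
  · intro h
    apply zmod_two_eq_one_of_ne_zero
    intro h0
    have h1 : invParity cs (t * w) t ≠ 0 := by
      rw [invParity_mul, invParity_self cs ht, show t⁻¹ * t * t = t by group, h0]; decide
    have := length_mul_lt_of_invParity_ne_zero cs h1
    rw [← mul_assoc, ht.mul_self, one_mul] at this
    omega
  · intro h
    exact length_mul_lt_of_invParity_ne_zero cs (by rw [h]; decide)

/-- The strong exchange property. -/
theorem mem_leftInvSeq_of_length_mul_lt (cs : CoxeterSystem M W) {ω : List B} {t : W}
    (ht : cs.IsReflection t) (h : cs.length (t * cs.wordProd ω) < cs.length (cs.wordProd ω)) :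
    t ∈ cs.leftInvSeq ω := by
  rw [length_mul_lt_iff_invParity cs ht] at h
  exact mem_leftInvSeq_of_invParity_ne_zero cs (by rw [h]; decide)

/-- The inversions of a product form the symmetric difference of the inversions of the left
factor and the conjugates of those of the right factor. -/
theorem length_mul_mul_lt_iff (cs : CoxeterSystem M W) {t : W} (ht : cs.IsReflection t)
    (a b : W) : cs.length (t * (a * b)) < cs.length (a * b) ↔
      ¬ (cs.length (t * a) < cs.length a ↔
        cs.length (a⁻¹ * t * a * b) < cs.length b) := by
  have ht' : cs.IsReflection (a⁻¹ * t * a) := by simpa using ht.conj a⁻¹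
  rw [length_mul_lt_iff_invParity cs ht, length_mul_lt_iff_invParity cs ht,
    length_mul_lt_iff_invParity cs ht', invParity_mul]
  generalize invParity cs a t = p
  generalize invParity cs b _ = q
  revert p q
  decide

end StrongExchange

section HeckeMax

/-- The longer one of `w` and `s w`. -/
noncomputable def leftMax (cs : CoxeterSystem M W) (i : B) (w : W) : W :=
  if cs.length w < cs.length (cs.simple i * w) then cs.simple i * w else w

/-- The longer one of `w` and `w s`. -/
noncomputable def rightMax (cs : CoxeterSystem M W) (w : W) (j : B) : W :=
  if cs.length w < cs.length (w * cs.simple j) then w * cs.simple j else w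

theorem simple_mul_eq_mul_simple (cs : CoxeterSystem M W) {w : W} {i j : B}
    (hi : cs.length w < cs.length (cs.simple i * w))
    (h : cs.length (cs.simple i * (w * cs.simple j)) < cs.length (w * cs.simple j)) :
    cs.simple i * w = w * cs.simple j := by
  rw [length_mul_mul_lt_iff cs (cs.isReflection_simple i), cs.length_simple] at h
  have h' : cs.length (w⁻¹ * cs.simple i * w * cs.simple j) = 0 := by
    by_contra h0
    apply h
    constructor <;> intro <;> omega
  rw [cs.length_eq_zero_iff, mul_eq_one_iff_eq_inv, cs.inv_simple] at h'
  rw [← h']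
  group

theorem leftMax_rightMax (cs : CoxeterSystem M W) (i j : B) (w : W) :
    leftMax cs i (rightMax cs w j) = rightMax cs (leftMax cs i w) j := by
  have h1 := cs.length_simple_mul w i
  have h2 := cs.length_mul_simple w j
  have h3 := cs.length_simple_mul (w * cs.simple j) i
  have h4 := cs.length_mul_simple (cs.simple i * w) j
  have h5 := @simple_mul_eq_mul_simple _ _ _ _ cs w i j
  rw [mul_assoc] at h4
  unfold leftMax rightMax
  by_cases hi : cs.length w < cs.length (cs.simple i * w) <;>
  by_cases hj : cs.length w < cs.length (w * cs.simple j)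
  · simp only [hi, hj, if_true, mul_assoc]
    by_cases h : cs.length (cs.simple i * (w * cs.simple j)) < cs.length (w * cs.simple j)
    · rw [if_neg (by omega), if_neg (by omega), h5 hi h]
    · rw [if_pos (by omega), if_pos (by omega)]
  · simp only [hi, hj, if_true, if_false, mul_assoc]
    rw [if_neg (by omega)]
  · simp only [hi, hj, if_true, if_false]
    rw [if_neg (by omega)]
  · simp only [hi, hj, if_false]

theorem length_le_length_rightMax (cs : CoxeterSystem M W) (w : W) (j : B) :
    cs.length w ≤ cs.length (rightMax cs w j) := by
  unfold rightMax
  split_ifs <;> omega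

theorem leftMax_foldl_rightMax (cs : CoxeterSystem M W) (i : B) (ω : List B) (w : W) :
    leftMax cs i (ω.foldl (rightMax cs) w) = ω.foldl (rightMax cs) (leftMax cs i w) := by
  induction ω generalizing w with
  | nil => rfl
  | cons j ω ih => rw [List.foldl_cons, List.foldl_cons, ih, leftMax_rightMax]

theorem length_le_length_foldl_rightMax (cs : CoxeterSystem M W) (ω : List B) (w : W) :
    cs.length w ≤ cs.length (ω.foldl (rightMax cs) w) := by
  induction ω generalizing w with
  | nil => rfl
  | cons j ω ih => exact (length_le_length_rightMax cs w j).trans (ih _)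

theorem isReduced_tail (cs : CoxeterSystem M W) {i : B} {ω : List B}
    (h : cs.IsReduced (i :: ω)) : cs.IsReduced ω := h.drop 1

theorem foldr_leftMax_eq_wordProd (cs : CoxeterSystem M W) {ω : List B} (h : cs.IsReduced ω) :
    ω.foldr (leftMax cs) 1 = cs.wordProd ω := by
  induction ω with
  | nil => simp
  | cons i ω ih =>
    have h' := isReduced_tail cs h
    rw [List.foldr_cons, ih h', leftMax, ← cs.wordProd_cons, if_pos]
    rw [h.eq, h'.eq]
    simp

theorem foldl_rightMax_eq_wordProd (cs : CoxeterSystem M W) {ω : List B} (h : cs.IsReduced ω) :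
    ω.foldl (rightMax cs) 1 = cs.wordProd ω := by
  induction ω using List.reverseRecOn with
  | nil => simp
  | append_singleton ω i ih =>
    have h' : cs.IsReduced ω := by simpa using h.take ω.length
    have e : cs.wordProd (ω ++ [i]) = cs.wordProd ω * cs.simple i := by
      simp [cs.wordProd_append]
    rw [List.foldl_append, ih h', List.foldl_cons, List.foldl_nil, rightMax, ← e, if_pos]
    rw [h.eq, h'.eq]
    simp

/-- A product of simple reflections which are left descents of `x` is at most as long as `x`. -/
theorem length_wordProd_le_of_descents (cs : CoxeterSystem M W) {x : W} {ω : List B}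
    (hω : cs.IsReduced ω) (hx : ∀ i ∈ ω, cs.IsLeftDescent x i) :
    cs.length (cs.wordProd ω) ≤ cs.length x := by
  obtain ⟨ρ, hρ, rfl⟩ := cs.exists_isReduced x
  have fixed : ∀ ω : List B, (∀ i ∈ ω, cs.IsLeftDescent (cs.wordProd ρ) i) →
      ω.foldr (leftMax cs) (cs.wordProd ρ) = cs.wordProd ρ := by
    intro ω hω
    induction ω with
    | nil => rfl
    | cons i ω ih =>
      rw [List.foldr_cons, ih fun j hj => hω j (List.mem_cons_of_mem i hj), leftMax, if_neg]
      exact (hω i List.mem_cons_self).asymm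
  have comm : ∀ ω : List B, ω.foldr (leftMax cs) (ρ.foldl (rightMax cs) 1) =
      ρ.foldl (rightMax cs) (ω.foldr (leftMax cs) 1) := by
    intro ω
    induction ω with
    | nil => rfl
    | cons i ω ih => rw [List.foldr_cons, List.foldr_cons, ih, leftMax_foldl_rightMax]
  have key := comm ω
  rw [foldl_rightMax_eq_wordProd cs hρ, fixed ω hx, foldr_leftMax_eq_wordProd cs hω] at key
  rw [key]
  exact length_le_length_foldl_rightMax cs ρ _

end HeckeMax

section Parabolic

variable (cs : CoxeterSystem M W) {Sg : Set W}

theorem isReflection_of_mem_simpleSet {s : W} (hs : s ∈ simpleSet cs) : cs.IsReflection s := by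
  obtain ⟨i, rfl⟩ := hs
  exact cs.isReflection_simple i

theorem subset_par : Sg ⊆ par Sg := Subgroup.subset_closure

theorem mem_par_of_mem_parRefl {t : W} (ht : t ∈ parRefl Sg) : t ∈ par Sg := by
  obtain ⟨u, hu, s, hs, rfl⟩ := ht
  exact mul_mem (mul_mem hu (subset_par hs)) (inv_mem hu)

theorem mem_parRefl_of_mem {s : W} (hs : s ∈ Sg) : s ∈ parRefl Sg :=
  ⟨1, one_mem _, s, hs, by simp⟩

theorem isReflection_of_mem_parRefl (hSg : Sg ⊆ simpleSet cs) {t : W} (ht : t ∈ parRefl Sg) :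
    cs.IsReflection t := by
  obtain ⟨u, -, s, hs, rfl⟩ := ht
  exact (isReflection_of_mem_simpleSet cs (hSg hs)).conj u

theorem par_induction (hSg : Sg ⊆ simpleSet cs) {p : W → Prop} (one : p 1)
    (mul : ∀ s ∈ Sg, ∀ x ∈ par Sg, p x → p (s * x)) {x : W} (hx : x ∈ par Sg) : p x := by
  refine Subgroup.closure_induction_left (p := fun x _ => p x) one mul ?_ hx
  intro s hs y hy h
  rw [(isReflection_of_mem_simpleSet cs (hSg hs)).inv]
  exact mul s hs y hy h

theorem length_mul_cases {s : W} (hs : s ∈ simpleSet cs) (x : W) :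
    cs.length (s * x) = cs.length x + 1 ∨ cs.length (s * x) + 1 = cs.length x := by
  obtain ⟨i, rfl⟩ := hs
  exact cs.length_simple_mul x i

theorem exists_reduced_word_of_mem_par (hSg : Sg ⊆ simpleSet cs) {y : W} (hy : y ∈ par Sg) :
    ∃ ω : List B, cs.IsReduced ω ∧ (∀ i ∈ ω, cs.simple i ∈ Sg) ∧ cs.wordProd ω = y := by
  refine par_induction cs hSg (p := fun y => ∃ ω : List B, cs.IsReduced ω ∧
    (∀ i ∈ ω, cs.simple i ∈ Sg) ∧ cs.wordProd ω = y) ⟨[], by simp [CoxeterSystem.IsReduced], by simp, by simp⟩ ?_ hy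
  rintro s hs x - ⟨ω, hω, hωS, rfl⟩
  obtain ⟨i, rfl⟩ := hSg hs
  have hlen := hω.eq
  rcases cs.length_simple_mul (cs.wordProd ω) i with h | h
  · refine ⟨i :: ω, ?_, ?_, cs.wordProd_cons i ω⟩
    · rw [CoxeterSystem.IsReduced, cs.wordProd_cons, h, hω.eq, List.length_cons]
    · simpa using ⟨hs, hωS⟩
  · have hmem := mem_leftInvSeq_of_length_mul_lt cs (ω := ω) (cs.isReflection_simple i) (by omega)
    obtain ⟨k, hk, hk'⟩ := List.mem_iff_getElem.mp hmem
    have he := cs.getD_leftInvSeq_mul_wordProd ω k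
    rw [List.getD_eq_getElem _ 1 hk, hk'] at he
    rw [cs.length_leftInvSeq] at hk
    refine ⟨ω.eraseIdx k, ?_, fun j hj => hωS j (List.mem_of_mem_eraseIdx hj), he.symm⟩
    have := List.length_eraseIdx_add_one hk
    rw [CoxeterSystem.IsReduced, ← he]
    omega

theorem length_mul_of_mem_minLeft (hSg : Sg ⊆ simpleSet cs) {m : W} (hm : m ∈ minLeft cs Sg)
    {x : W} (hx : x ∈ par Sg) : cs.length (x * m) = cs.length x + cs.length m := by
  refine par_induction cs hSg (p := fun x => cs.length (x * m) = cs.length x + cs.length m)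
    (by simp) ?_ hx
  intro s hs x hx ih
  have ht : x⁻¹ * s * x ∈ parRefl Sg := ⟨x⁻¹, inv_mem hx, s, hs, by simp⟩
  have hn : ¬ cs.length (x⁻¹ * s * x * m) < cs.length m := fun h =>
    (Set.eq_empty_iff_forall_notMem.mp hm) _ ⟨⟨isReflection_of_mem_parRefl cs hSg ht, h⟩, ht⟩
  have h := length_mul_mul_lt_iff cs (isReflection_of_mem_simpleSet cs (hSg hs)) x m
  have h1 := length_mul_cases cs (hSg hs) x
  have h2 := length_mul_cases cs (hSg hs) (x * m)
  rw [mul_assoc]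
  by_cases h3 : cs.length (s * x) < cs.length x
  · have := h.2 (by tauto)
    omega
  · have : ¬ cs.length (s * (x * m)) < cs.length (x * m) := by tauto
    omega

theorem mem_minLeft_of_length_le {m : W} (hm : ∀ x ∈ par Sg, cs.length m ≤ cs.length (x * m)) :
    m ∈ minLeft cs Sg := by
  refine Set.eq_empty_iff_forall_notMem.mpr ?_
  rintro t ⟨⟨-, ht⟩, ht'⟩
  exact absurd (hm t (mem_par_of_mem_parRefl ht')) (by omega)

theorem exists_par_mul_minLeft (v : W) :
    ∃ x ∈ par Sg, ∃ m, v = x * m ∧ ∀ y ∈ par Sg, cs.length m ≤ cs.length (y * m) := by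
  obtain ⟨x, hx, hmin⟩ : ∃ x ∈ par Sg, ∀ y ∈ par Sg, cs.length (x * v) ≤ cs.length (y * v) := by
    have := exists_minimalFor_of_wellFoundedLT (fun x => x ∈ par Sg)
      (fun x => cs.length (x * v)) ⟨1, one_mem _⟩
    obtain ⟨x, hx, h⟩ := this
    refine ⟨x, hx, fun y hy => ?_⟩
    rcases le_total (cs.length (x * v)) (cs.length (y * v)) with h' | h'
    · exact h'
    · exact h hy h'
  refine ⟨x⁻¹, inv_mem hx, x * v, by group, fun y hy => ?_⟩
  rw [← mul_assoc]
  exact hmin _ (mul_mem hy hx)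

theorem exists_isLongest_of_finite (hfin : (par Sg : Set W).Finite) :
    ∃ w, IsLongest cs Sg w := by
  obtain ⟨w, hw, h⟩ := Set.exists_max_image _ cs.length hfin ⟨1, one_mem (par Sg)⟩
  exact ⟨w, hw, h⟩

theorem isLongest_longest (hfin : (par Sg : Set W).Finite) :
    IsLongest cs Sg (longest cs Sg) := by
  have h := exists_isLongest_of_finite cs hfin
  rw [longest, dif_pos h]
  exact h.choose_spec

theorem isLongest_of_descents (hSg : Sg ⊆ simpleSet cs) {x : W} (hx : x ∈ par Sg)
    (hd : ∀ s ∈ Sg, cs.length (s * x) < cs.length x) : IsLongest cs Sg x := by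
  refine ⟨hx, fun u hu => ?_⟩
  obtain ⟨ω, hω, hωS, rfl⟩ := exists_reduced_word_of_mem_par cs hSg hu
  exact length_wordProd_le_of_descents cs hω fun i hi => hd _ (hωS i hi)

theorem finite_par_of_isLongest (hSg : Sg ⊆ simpleSet cs) (hfin : Sg.Finite) {x : W}
    (hx : IsLongest cs Sg x) : (par Sg : Set W).Finite := by
  have key : ∀ n : ℕ, {y : W | ∃ ω : List B, ω.length = n ∧ (∀ i ∈ ω, cs.simple i ∈ Sg) ∧
      cs.wordProd ω = y}.Finite := by
    intro n
    induction n with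
    | zero =>
      refine (Set.finite_singleton (1 : W)).subset ?_
      rintro y ⟨ω, h, -, rfl⟩
      simp [List.length_eq_zero_iff.mp h]
    | succ n ih =>
      refine (hfin.image2 (· * ·) ih).subset ?_
      rintro y ⟨ω, h, hω, rfl⟩
      obtain ⟨i, ω, rfl⟩ := List.exists_cons_of_length_eq_add_one h
      exact ⟨cs.simple i, hω i List.mem_cons_self, cs.wordProd ω,
        ⟨ω, by simpa using h, fun j hj => hω j (List.mem_cons_of_mem i hj), rfl⟩,
        (cs.wordProd_cons i ω).symm⟩
  refine ((Set.finite_Iic (cs.length x)).biUnion fun n _ => key n).subset ?_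
  intro y hy
  obtain ⟨ω, hω, hωS, rfl⟩ := exists_reduced_word_of_mem_par cs hSg hy
  exact Set.mem_biUnion (x := ω.length) (by rw [← hω.eq]; exact hx.2 _ hy) ⟨ω, rfl, hωS, rfl⟩

variable {cs}

theorem IsLongest.length_mul_add (hSg : Sg ⊆ simpleSet cs) {x : W} (hx : IsLongest cs Sg x)
    {y : W} (hy : y ∈ par Sg) : cs.length (y * x) + cs.length y = cs.length x := by
  refine par_induction cs hSg (p := fun y => cs.length (y * x) + cs.length y = cs.length x)
    (by simp) ?_ hy
  intro s hs y hy ih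
  have ht : y⁻¹ * s * y ∈ parRefl Sg := ⟨y⁻¹, inv_mem hy, s, hs, by simp⟩
  have hlt : cs.length (y⁻¹ * s * y * x) < cs.length x :=
    lt_of_le_of_ne (hx.2 _ (mul_mem (mem_par_of_mem_parRefl ht) hx.1))
      ((isReflection_of_mem_parRefl cs hSg ht).length_mul_right_ne x)
  have h := length_mul_mul_lt_iff cs (isReflection_of_mem_simpleSet cs (hSg hs)) y x
  have h1 := length_mul_cases cs (hSg hs) y
  have h2 := length_mul_cases cs (hSg hs) (y * x)
  rw [mul_assoc]
  by_cases h3 : cs.length (s * y) < cs.length y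
  · have : ¬ cs.length (s * (y * x)) < cs.length (y * x) := by tauto
    omega
  · have := h.2 (by tauto)
    omega

theorem IsLongest.eq (hSg : Sg ⊆ simpleSet cs) {x y : W} (hx : IsLongest cs Sg x)
    (hy : y ∈ par Sg) (hlen : cs.length x ≤ cs.length y) : y = x := by
  have h := hx.length_mul_add hSg (inv_mem hy)
  rw [cs.length_inv] at h
  have h0 : cs.length (y⁻¹ * x) = 0 := by omega
  rw [cs.length_eq_zero_iff] at h0
  exact inv_mul_eq_one.mp h0

theorem IsLongest.inv_eq (hSg : Sg ⊆ simpleSet cs) {x : W} (hx : IsLongest cs Sg x) :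
    x⁻¹ = x :=
  hx.eq hSg (inv_mem hx.1) (by rw [cs.length_inv])

theorem IsLongest.mul_self (hSg : Sg ⊆ simpleSet cs) {x : W} (hx : IsLongest cs Sg x) :
    x * x = 1 := by
  nth_rw 1 [← hx.inv_eq hSg]
  exact inv_mul_cancel x

theorem IsLongest.length_conj (hSg : Sg ⊆ simpleSet cs) {x : W} (hx : IsLongest cs Sg x)
    {y : W} (hy : y ∈ par Sg) : cs.length (x * y * x) = cs.length y := by
  have h1 := hx.length_mul_add hSg (mul_mem hx.1 hy)
  have h2 := hx.length_mul_add hSg (inv_mem hy)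
  have h3 : cs.length (x * y) = cs.length (y⁻¹ * x) := by
    rw [← cs.length_inv, mul_inv_rev, hx.inv_eq hSg]
  rw [cs.length_inv] at h2
  omega

variable (cs)

theorem mem_relW_iff {w : W} : w ∈ relW cs Sg ↔
    w ∈ Subgroup.normalizer (par Sg : Set W) ∧ w ∈ minLeft cs Sg := by
  rw [Subgroup.mem_normalizer_iff_conj_image_eq]
  rfl

theorem length_mul_of_mem_relW (hSg : Sg ⊆ simpleSet cs) {w : W} (hw : w ∈ relW cs Sg)
    {x : W} (hx : x ∈ par Sg) : cs.length (w * x) = cs.length w + cs.length x := by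
  rw [mem_relW_iff] at hw
  have hmin : w⁻¹ ∈ minLeft cs Sg := by
    refine mem_minLeft_of_length_le cs fun y hy => ?_
    have h : w * y⁻¹ * w⁻¹ ∈ par Sg := (Subgroup.mem_normalizer_iff.mp hw.1 _).mp (inv_mem hy)
    have h' := length_mul_of_mem_minLeft cs hSg hw.2 h
    rw [inv_mul_cancel_right] at h'
    rw [cs.length_inv, ← cs.length_inv (y * w⁻¹), mul_inv_rev, inv_inv]
    omega
  have h := length_mul_of_mem_minLeft cs hSg hmin (inv_mem hx)
  rw [← mul_inv_rev, cs.length_inv, cs.length_inv, cs.length_inv] at h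
  omega

/-- The longest element of `W_Σ` commutes with every element of `W̃`. -/
theorem longest_mul_comm_of_mem_relW (hSg : Sg ⊆ simpleSet cs) {w₀ w : W}
    (h₀ : IsLongest cs Sg w₀) (hw : w ∈ relW cs Sg) : w₀ * w = w * w₀ := by
  have hw' := hw
  rw [mem_relW_iff] at hw'
  have hmem : w * w₀ * w⁻¹ ∈ par Sg := (Subgroup.mem_normalizer_iff.mp hw'.1 _).mp h₀.1
  have h1 := length_mul_of_mem_minLeft cs hSg hw'.2 hmem
  have h2 := length_mul_of_mem_relW cs hSg hw h₀.1
  rw [inv_mul_cancel_right] at h1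
  have h3 := h₀.eq hSg hmem (by omega)
  nth_rw 1 [← h3]
  group

theorem finite_of_finite_par (hfin : (par Sg : Set W).Finite) : Sg.Finite :=
  hfin.subset subset_par

theorem descent_factorization (hSg : Sg ⊆ simpleSet cs) (hfin : (par Sg : Set W).Finite)
    {w : W} (hw : w ∈ relW cs Sg) {s : W} (hs : s ∈ descSet cs w) :
    s ∈ complSet cs Sg ∧ tilde cs Sg s * w ∈ minLeft cs (Sg ∪ {s}) ∧
      cs.length (tilde cs Sg s * w) + cs.length (tilde cs Sg s) = cs.length w := by
  have hw' := hw
  rw [mem_relW_iff] at hw'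
  have hsub : Sg ∪ {s} ⊆ simpleSet cs := Set.union_subset hSg (by simpa using hs.2)
  have hsSg : s ∉ Sg := fun h =>
    Set.eq_empty_iff_forall_notMem.mp hw.2 s ⟨hs.1, mem_parRefl_of_mem h⟩
  have h₀ := isLongest_longest cs hfin
  set w₀ := longest cs Sg with hw₀
  have hcomm := longest_mul_comm_of_mem_relW cs hSg h₀ hw
  have hlen := length_mul_of_mem_minLeft cs hSg hw'.2 h₀.1
  have hdesc : ∀ r ∈ Sg ∪ {s}, cs.length (r * (w₀ * w)) < cs.length (w₀ * w) := by
    rintro r (hr | hr)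
    · have h1 := length_mul_of_mem_minLeft cs hSg hw'.2 (mul_mem (subset_par hr) h₀.1)
      have h2 := h₀.2 _ (mul_mem (subset_par hr) h₀.1)
      have h3 := length_mul_cases cs (hSg hr) w₀
      rw [← mul_assoc]
      omega
    · rw [Set.mem_singleton_iff] at hr
      subst hr
      have h1 := cs.length_mul_le (r * w) w₀
      have h2 := hs.1.2
      rw [hlen, hcomm, ← mul_assoc]
      omega
  obtain ⟨x, hx, m, hv, hmin⟩ := exists_par_mul_minLeft cs (Sg := Sg ∪ {s}) (w₀ * w)
  have hm := mem_minLeft_of_length_le cs hmin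
  have hvlen := length_mul_of_mem_minLeft cs hsub hm hx
  have hxlong : IsLongest cs (Sg ∪ {s}) x := by
    refine isLongest_of_descents cs hsub hx fun r hr => ?_
    have h1 := hdesc r hr
    have h2 := length_mul_of_mem_minLeft cs hsub hm (mul_mem (subset_par hr) hx)
    rw [hv, ← mul_assoc] at h1
    omega
  have hfin' := finite_par_of_isLongest cs hsub
    ((finite_of_finite_par hfin).union (Set.finite_singleton s)) hxlong
  have hxeq : longest cs (Sg ∪ {s}) = x :=
    hxlong.eq hsub (isLongest_longest cs hfin').1 ((isLongest_longest cs hfin').2 _ hx)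
  have htw : tilde cs Sg s * w = m := by
    rw [tilde, hxeq, mul_assoc, ← hw₀, hv, ← mul_assoc, hxlong.mul_self hsub, one_mul]
  refine ⟨⟨⟨hs.2, hsSg⟩, hfin'⟩, htw ▸ hm, ?_⟩
  have hle : w₀ ∈ par (Sg ∪ {s}) := Subgroup.closure_mono Set.subset_union_left h₀.1
  have h4 := hxlong.length_mul_add hsub hle
  have h5 : cs.length (tilde cs Sg s) = cs.length (w₀ * x) := by
    rw [tilde, hxeq, ← hw₀, ← cs.length_inv, mul_inv_rev, hxlong.inv_eq hsub, h₀.inv_eq hSg]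
  rw [htw, h5]
  rw [hv] at hlen
  omega

theorem tilde_mul_self_of_goodSubset (hSg : GoodSubset cs Sg) {s : W} (hs : s ∈ complSet cs Sg) :
    tilde cs Sg s * tilde cs Sg s = 1 ∧
      tilde cs Sg s ∈ Subgroup.normalizer (par Sg : Set W) := by
  obtain ⟨hS, hfin, hnorm⟩ := hSg
  have hsub : Sg ∪ {s} ⊆ simpleSet cs := Set.union_subset hS (by simpa using hs.1.1)
  have h₀ := isLongest_longest cs hfin
  have h₁ := isLongest_longest cs hs.2
  have hn : longest cs (Sg ∪ {s}) ∈ Subgroup.normalizer (par Sg : Set W) := by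
    rw [Subgroup.mem_normalizer_iff_conj_image_eq]
    exact hnorm _ Set.subset_union_left hsub hs.2 _ h₁
  rw [tilde]
  set w₀ := longest cs Sg
  set w₁ := longest cs (Sg ∪ {s})
  have hmem : w₁ * w₀ * w₁ ∈ par Sg := by
    have := (Subgroup.mem_normalizer_iff.mp hn w₀).mp h₀.1
    rwa [h₁.inv_eq hsub] at this
  have hlen := h₁.length_conj hsub (Subgroup.closure_mono Set.subset_union_left h₀.1)
  have heq := h₀.eq hS hmem hlen.ge
  refine ⟨?_, mul_mem hn (Subgroup.le_normalizer h₀.1)⟩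
  rw [← mul_assoc, heq, h₀.mul_self hS]

theorem minLeft_anti {Sg' : Set W} (h : Sg ⊆ Sg') : minLeft cs Sg' ⊆ minLeft cs Sg := by
  intro m hm
  refine Set.eq_empty_iff_forall_notMem.mpr ?_
  rintro t ⟨ht, u, hu, s, hs, rfl⟩
  exact Set.eq_empty_iff_forall_notMem.mp hm _
    ⟨ht, u, Subgroup.closure_mono h hu, s, h hs, rfl⟩

theorem exists_relS_decomposition (hSg : GoodSubset cs Sg) {w : W} (hw : w ∈ relW cs Sg) :
    ∃ l : List W, (∀ x ∈ l, x ∈ relS cs Sg) ∧ l.prod = w := by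
  induction hn : cs.length w using Nat.strong_induction_on generalizing w with
  | _ n ih =>
    subst hn
    by_cases hw1 : w = 1
    · exact ⟨[], by simp, by simp [hw1]⟩
    obtain ⟨i, hi⟩ := cs.exists_leftDescent_of_ne_one hw1
    have hs : cs.simple i ∈ descSet cs w := ⟨⟨cs.isReflection_simple i, hi⟩, i, rfl⟩
    obtain ⟨hcompl, hmin, hlen⟩ := descent_factorization cs hSg.1 hSg.2.1 hw hs
    obtain ⟨hself, hnorm⟩ := tilde_mul_self_of_goodSubset cs hSg hcompl
    set σ := tilde cs Sg (cs.simple i)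
    have hσw : σ * w ∈ relW cs Sg := by
      rw [mem_relW_iff] at hw ⊢
      exact ⟨mul_mem hnorm hw.1, minLeft_anti cs Set.subset_union_left hmin⟩
    have hne : cs.length σ ≠ 0 := by
      intro h0
      rw [cs.length_eq_zero_iff] at h0
      rw [h0, one_mul] at hmin
      exact Set.eq_empty_iff_forall_notMem.mp hmin _
        ⟨hs.1, mem_parRefl_of_mem (Set.mem_union_right Sg rfl)⟩
    obtain ⟨l, hl, hprod⟩ := ih _ (by omega) hσw rfl
    refine ⟨σ :: l, ?_, ?_⟩
    · simpa using ⟨⟨_, hcompl, rfl⟩, hl⟩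
    · rw [List.prod_cons, hprod, ← mul_assoc, hself, one_mul]

end Parabolic

variable (cs : CoxeterSystem M W)

/-- `S̃` generates `W̃` (so `ℓ̃(w) < ∞` for all `w ∈ W̃`); moreover for
`w ∈ W̃`, `w ≠ e`, and `s ∈ D(w)` one has `s ∈ S ∖ Σ`, `s ∈ Σ^∁`, and
`ℓ(s̃ w) = ℓ(w) − ℓ(s̃)` where `s̃ = w₀^{Σ∪{s}} w₀^Σ`. -/
theorem relS_generates_relW (Sg : Set W) (hSg : GoodSubset cs Sg) :
    (∀ w ∈ relW cs Sg, ∃ l : List W, (∀ x ∈ l, x ∈ relS cs Sg) ∧ l.prod = w) ∧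
    (∀ w ∈ relW cs Sg, relLength cs Sg w < ⊤) ∧
    (∀ w ∈ relW cs Sg, w ≠ 1 → ∀ s ∈ descSet cs w,
      s ∈ simpleSet cs \ Sg ∧ s ∈ complSet cs Sg ∧
      cs.length (tilde cs Sg s * w) + cs.length (tilde cs Sg s) = cs.length w) := by
  refine ⟨fun w hw => exists_relS_decomposition cs hSg hw, fun w hw => ?_,
    fun w hw _ s hs => ?_⟩
  · obtain ⟨l, hl, hprod⟩ := exists_relS_decomposition cs hSg hw
    have hle : relLength cs Sg w ≤ (l.length : ℕ∞) := sInf_le ⟨l, hl, hprod, rfl⟩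
    exact hle.trans_lt (ENat.natCast_lt_top _)
  · obtain ⟨hcompl, -, hlen⟩ := descent_factorization cs hSg.1 hSg.2.1 hw hs
    exact ⟨hcompl.1, hcompl, hlen⟩

end RelativeCoxeter
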